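/- The scaled residuals θ₁^ε := ε⁻¹(θ_ε − θ_*), φ₂^ε := ε⁻²(φ_ε − φ₀), y₂^ε := ε⁻²(y_ε − y₀), p₂^ε := ε⁻²(p_ε − p₀) are uniformly bounded in L^∞((0,T)) as ε → 0. -/

import Mathlib

open Real Set Filter Topology

/-- `F ε t` is `O(ε ^ k)`, uniformly for `0 < ε < ε₀` and `t ∈ [0, T]`. -/
def UnifBigO (ε₀ T : ℝ) (k : ℕ) (F : ℝ → ℝ → ℝ) : Prop :=
  ∃ M : ℝ, 0 ≤ M ∧ ∀ ε ∈ Ioo 0 ε₀, ∀ t ∈ Icc 0 T, |F ε t| ≤ M * ε ^ k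

/-- `F' ε` is the derivative of `F ε` on `[0, T]`, for all `0 < ε < ε₀`. -/
def HasTimeDeriv (ε₀ T : ℝ) (F F' : ℝ → ℝ → ℝ) : Prop :=
  ∀ ε ∈ Ioo 0 ε₀, ∀ t ∈ Icc 0 T, HasDerivAt (F ε) (F' ε t) t

/-- `F` and its time derivative are uniformly bounded. -/
def Slow (ε₀ T : ℝ) (F : ℝ → ℝ → ℝ) : Prop :=
  UnifBigO ε₀ T 0 F ∧ ∃ F', HasTimeDeriv ε₀ T F F' ∧ UnifBigO ε₀ T 0 F'

/-- `F` is, up to an error `O(ε ^ k)`, the time derivative of a function of size `O(ε ^ k)`. -/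
def WeakBigO (ε₀ T : ℝ) (k : ℕ) (F : ℝ → ℝ → ℝ) : Prop :=
  ∃ G R, UnifBigO ε₀ T k G ∧ UnifBigO ε₀ T k R ∧ HasTimeDeriv ε₀ T G (F - R)

/-- The small parameter as a function of `(ε, t)`. -/
def smallParam : ℝ → ℝ → ℝ := fun ε _ => ε

section Calculus

variable {ε₀ T : ℝ} {k l : ℕ} {F G F' G' : ℝ → ℝ → ℝ}

namespace UnifBigO

lemma congr (hF : UnifBigO ε₀ T k F) (h : ∀ ε ∈ Ioo 0 ε₀, ∀ t ∈ Icc 0 T, G ε t = F ε t) :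
    UnifBigO ε₀ T k G := by
  obtain ⟨M, hM, hb⟩ := hF
  exact ⟨M, hM, fun ε hε t ht => by rw [h ε hε t ht]; exact hb ε hε t ht⟩

lemma of_abs_le {M : ℝ} (h : ∀ ε ∈ Ioo 0 ε₀, ∀ t ∈ Icc 0 T, |F ε t| ≤ M) :
    UnifBigO ε₀ T 0 F :=
  ⟨|M|, abs_nonneg M, fun ε hε t ht => by
    rw [pow_zero, mul_one]; exact (h ε hε t ht).trans (le_abs_self M)⟩

lemma add (hF : UnifBigO ε₀ T k F) (hG : UnifBigO ε₀ T k G) : UnifBigO ε₀ T k (F + G) := by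
  obtain ⟨M, hM, hF⟩ := hF
  obtain ⟨N, hN, hG⟩ := hG
  refine ⟨M + N, add_nonneg hM hN, fun ε hε t ht => ?_⟩
  rw [add_mul]
  exact (abs_add_le _ _).trans (add_le_add (hF ε hε t ht) (hG ε hε t ht))

lemma neg (hF : UnifBigO ε₀ T k F) : UnifBigO ε₀ T k (-F) := by
  obtain ⟨M, hM, hF⟩ := hF
  exact ⟨M, hM, fun ε hε t ht => by rw [Pi.neg_apply, Pi.neg_apply, abs_neg]; exact hF ε hε t ht⟩

lemma sub (hF : UnifBigO ε₀ T k F) (hG : UnifBigO ε₀ T k G) : UnifBigO ε₀ T k (F - G) := by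
  rw [sub_eq_add_neg]; exact hF.add hG.neg

lemma mul (hF : UnifBigO ε₀ T k F) (hG : UnifBigO ε₀ T l G) :
    UnifBigO ε₀ T (k + l) (F * G) := by
  obtain ⟨M, hM, hF⟩ := hF
  obtain ⟨N, hN, hG⟩ := hG
  refine ⟨M * N, mul_nonneg hM hN, fun ε hε t ht => ?_⟩
  calc |F ε t * G ε t| = |F ε t| * |G ε t| := abs_mul _ _
    _ ≤ (M * ε ^ k) * (N * ε ^ l) :=
      mul_le_mul (hF ε hε t ht) (hG ε hε t ht) (abs_nonneg _)
        (mul_nonneg hM (pow_nonneg hε.1.le _))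
    _ = M * N * ε ^ (k + l) := by ring

/-- A bounded factor preserves the order, on the right. -/
lemma mul_bdd (hF : UnifBigO ε₀ T k F) (hG : UnifBigO ε₀ T 0 G) : UnifBigO ε₀ T k (F * G) :=
  hF.mul hG

lemma const (c : ℝ) : UnifBigO ε₀ T 0 (fun _ _ => c) :=
  of_abs_le fun _ _ _ _ => le_refl |c|

lemma smallParam_mul (hF : UnifBigO ε₀ T k F) : UnifBigO ε₀ T (k + 1) (smallParam * F) := by
  obtain ⟨M, hM, hF⟩ := hF
  refine ⟨M, hM, fun ε hε t ht => ?_⟩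
  have h := mul_le_mul_of_nonneg_left (hF ε hε t ht) hε.1.le
  calc |ε * F ε t| = ε * |F ε t| := by rw [abs_mul, abs_of_pos hε.1]
    _ ≤ ε * (M * ε ^ k) := h
    _ = M * ε ^ (k + 1) := by ring

lemma of_succ (hε₀ : ε₀ ≤ 1) (hF : UnifBigO ε₀ T (k + 1) F) : UnifBigO ε₀ T k F := by
  obtain ⟨M, hM, hF⟩ := hF
  refine ⟨M, hM, fun ε hε t ht => (hF ε hε t ht).trans (mul_le_mul_of_nonneg_left ?_ hM)⟩
  exact pow_le_pow_of_le_one hε.1.le (hε.2.le.trans hε₀) (Nat.le_succ k)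

lemma comp {R : ℝ} {y : ℝ → ℝ → ℝ} (hR : ∀ ε ∈ Ioo 0 ε₀, ∀ t ∈ Icc 0 T, |y ε t| ≤ R)
    {g : ℝ → ℝ} (hg : Continuous g) : UnifBigO ε₀ T 0 (fun ε t => g (y ε t)) := by
  obtain ⟨C, hC⟩ := (isCompact_Icc (a := -R) (b := R)).exists_bound_of_continuousOn hg.continuousOn
  exact .of_abs_le fun ε hε t ht => hC _ (abs_le.1 (hR ε hε t ht))

end UnifBigO

namespace HasTimeDeriv

lemma add (hF : HasTimeDeriv ε₀ T F F') (hG : HasTimeDeriv ε₀ T G G') :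
    HasTimeDeriv ε₀ T (F + G) (F' + G') :=
  fun ε hε t ht => (hF ε hε t ht).add (hG ε hε t ht)

lemma sub (hF : HasTimeDeriv ε₀ T F F') (hG : HasTimeDeriv ε₀ T G G') :
    HasTimeDeriv ε₀ T (F - G) (F' - G') :=
  fun ε hε t ht => (hF ε hε t ht).sub (hG ε hε t ht)

lemma mul (hF : HasTimeDeriv ε₀ T F F') (hG : HasTimeDeriv ε₀ T G G') :
    HasTimeDeriv ε₀ T (F * G) (F' * G + F * G') :=
  fun ε hε t ht => (hF ε hε t ht).mul (hG ε hε t ht)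

lemma const (c : ℝ) : HasTimeDeriv ε₀ T (fun _ _ => c) 0 :=
  fun _ _ t _ => hasDerivAt_const t c

lemma smallParam_mul (hF : HasTimeDeriv ε₀ T F F') :
    HasTimeDeriv ε₀ T (smallParam * F) (smallParam * F') :=
  fun ε hε t ht => (hF ε hε t ht).const_mul ε

lemma congr (hF : HasTimeDeriv ε₀ T F F')
    (h : ∀ ε ∈ Ioo 0 ε₀, ∀ t ∈ Icc 0 T, G' ε t = F' ε t) : HasTimeDeriv ε₀ T F G' :=
  fun ε hε t ht => by rw [h ε hε t ht]; exact hF ε hε t ht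

/-- A function starting at `0` whose derivative is uniformly `O(ε ^ k)` is itself `O(ε ^ k)`;
the initial value may also be of that size. -/
lemma unifBigO (hT : 0 ≤ T) (hF : HasTimeDeriv ε₀ T F F') (hF' : UnifBigO ε₀ T k F')
    (h0 : UnifBigO ε₀ T k fun ε _ => F ε 0) : UnifBigO ε₀ T k F := by
  obtain ⟨M, hM, hF'⟩ := hF'
  obtain ⟨N, hN, h0⟩ := h0
  refine ⟨N + M * T, by positivity, fun ε hε t ht => ?_⟩
  have hεk : 0 ≤ ε ^ k := pow_nonneg hε.1.le _
  have h := norm_image_sub_le_of_norm_deriv_le_segment'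
    (fun x hx => (hF ε hε x hx).hasDerivWithinAt)
    (fun x hx => hF' ε hε x (Ico_subset_Icc_self hx)) t ht
  rw [Real.norm_eq_abs, sub_zero] at h
  have h1 : M * ε ^ k * t ≤ M * ε ^ k * T := mul_le_mul_of_nonneg_left ht.2 (by positivity)
  have h2 := abs_sub_abs_le_abs_sub (F ε t) (F ε 0)
  have h3 := h0 ε hε t ht
  linarith

end HasTimeDeriv

namespace Slow

lemma bdd (hF : Slow ε₀ T F) : UnifBigO ε₀ T 0 F := hF.1

lemma sub (hF : Slow ε₀ T F) (hG : Slow ε₀ T G) : Slow ε₀ T (F - G) := by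
  obtain ⟨hF, F', hF', bF'⟩ := hF
  obtain ⟨hG, G', hG', bG'⟩ := hG
  exact ⟨hF.sub hG, F' - G', hF'.sub hG', bF'.sub bG'⟩

lemma mul (hF : Slow ε₀ T F) (hG : Slow ε₀ T G) : Slow ε₀ T (F * G) := by
  obtain ⟨hF, F', hF', bF'⟩ := hF
  obtain ⟨hG, G', hG', bG'⟩ := hG
  exact ⟨hF.mul hG, F' * G + F * G', hF'.mul hG', (bF'.mul hG).add (hF.mul bG')⟩

lemma const (c : ℝ) : Slow ε₀ T (fun _ _ => c) :=
  ⟨.const c, 0, .const c, .const 0⟩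

lemma comp {R : ℝ} {y : ℝ → ℝ → ℝ} (hy : Slow ε₀ T y)
    (hR : ∀ ε ∈ Ioo 0 ε₀, ∀ t ∈ Icc 0 T, |y ε t| ≤ R) {g g' : ℝ → ℝ}
    (hg : ∀ x, HasDerivAt g (g' x) x) (hg' : Continuous g') :
    Slow ε₀ T (fun ε t => g (y ε t)) := by
  have hgc : Continuous g := continuous_iff_continuousAt.2 fun x => (hg x).continuousAt
  obtain ⟨-, y', hy', by'⟩ := hy
  exact ⟨.comp hR hgc, (fun ε t => g' (y ε t)) * y',
    fun ε hε t ht => (hg _).comp t (hy' ε hε t ht), (UnifBigO.comp hR hg').mul by'⟩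

end Slow

namespace WeakBigO

lemma congr (hF : WeakBigO ε₀ T k F) (h : ∀ ε ∈ Ioo 0 ε₀, ∀ t ∈ Icc 0 T, G ε t = F ε t) :
    WeakBigO ε₀ T k G := by
  obtain ⟨A, R, hA, hR, hd⟩ := hF
  refine ⟨A, R, hA, hR, hd.congr fun ε hε t ht => ?_⟩
  simp only [Pi.sub_apply, h ε hε t ht]

lemma add (hF : WeakBigO ε₀ T k F) (hG : WeakBigO ε₀ T k G) : WeakBigO ε₀ T k (F + G) := by
  obtain ⟨A, R, hA, hR, hd⟩ := hF
  obtain ⟨A', R', hA', hR', hd'⟩ := hG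
  exact ⟨A + A', R + R', hA.add hA', hR.add hR', (hd.add hd').congr fun ε _ t _ => by
    simp only [Pi.sub_apply, Pi.add_apply]; ring⟩

lemma smallParam_mul (hF : WeakBigO ε₀ T k F) : WeakBigO ε₀ T (k + 1) (smallParam * F) := by
  obtain ⟨A, R, hA, hR, hd⟩ := hF
  exact ⟨smallParam * A, smallParam * R, hA.smallParam_mul, hR.smallParam_mul,
    hd.smallParam_mul.congr fun ε _ t _ => by
      simp only [Pi.sub_apply, Pi.mul_apply]; ring⟩

/-- Integrating a weakly small function gives a small function. -/
lemma unifBigO_of_hasTimeDeriv (hT : 0 ≤ T) {Z : ℝ → ℝ → ℝ} (hF : WeakBigO ε₀ T k F)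
    (hZ : HasTimeDeriv ε₀ T Z F) (h0 : ∀ ε ∈ Ioo 0 ε₀, Z ε 0 = 0) : UnifBigO ε₀ T k Z := by
  obtain ⟨A, R, hA, hR, hd⟩ := hF
  have hR' : HasTimeDeriv ε₀ T (Z - A) R :=
    (hZ.sub hd).congr fun ε _ t _ => by simp only [Pi.sub_apply]; ring
  have hb : UnifBigO ε₀ T k (Z - A) := by
    refine hR'.unifBigO hT hR ?_
    obtain ⟨M, hM, hA⟩ := hA
    refine ⟨M, hM, fun ε hε t ht => ?_⟩
    have := hA ε hε 0 ⟨le_rfl, hT⟩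
    simpa [h0 ε hε] using this
  exact (hb.add hA).congr fun ε _ t _ => by simp

end WeakBigO

lemma UnifBigO.weakBigO (hF : UnifBigO ε₀ T k F) : WeakBigO ε₀ T k F :=
  ⟨0, F, ⟨0, le_rfl, fun _ _ _ _ => by simp⟩, hF,
    (HasTimeDeriv.const 0).congr fun _ _ _ _ => by simp⟩

section Oscillation

variable {φ φ' w wi c : ℝ → ℝ → ℝ}

lemma UnifBigO.sin_phase (n : ℝ) : UnifBigO ε₀ T 0 (fun ε t => Real.sin (n * φ ε t / ε)) :=
  .of_abs_le fun _ _ _ _ => Real.abs_sin_le_one _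

lemma UnifBigO.cos_phase (n : ℝ) : UnifBigO ε₀ T 0 (fun ε t => Real.cos (n * φ ε t / ε)) :=
  .of_abs_le fun _ _ _ _ => Real.abs_cos_le_one _

/-- Oscillatory integral estimate, sine version. -/
lemma Slow.weakBigO_mul_sin {n : ℝ} (hn : n ≠ 0) (hφ : HasTimeDeriv ε₀ T φ φ')
    (hφw : UnifBigO ε₀ T 1 (φ' - w)) (hwi : Slow ε₀ T wi)
    (hw : ∀ ε t, w ε t * wi ε t = 1) (hc : Slow ε₀ T c) :
    WeakBigO ε₀ T 1 (c * fun ε t => Real.sin (n * φ ε t / ε)) := by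
  have hd := hc.mul (hwi.mul (Slow.const (-n⁻¹)))
  obtain ⟨hdb, d', hd', hd'b⟩ := hd
  refine ⟨smallParam * ((c * (wi * fun _ _ => -n⁻¹)) * fun ε t => Real.cos (n * φ ε t / ε)),
    -(smallParam * (d' * fun ε t => Real.cos (n * φ ε t / ε)))
      - (φ' - w) * (c * wi * fun ε t => Real.sin (n * φ ε t / ε)),
    (hdb.mul (.cos_phase n)).smallParam_mul,
    (hd'b.mul (.cos_phase n)).smallParam_mul.neg.sub
      (hφw.mul_bdd ((hc.bdd.mul hwi.bdd).mul (.sin_phase n))), fun ε hε t ht => ?_⟩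
  have hε0 : ε ≠ 0 := hε.1.ne'
  have h1 := (((hφ ε hε t ht).const_mul n).div_const ε).cos
  have h2 := ((hd' ε hε t ht).mul h1).const_mul ε
  refine h2.congr_deriv ?_
  simp only [Pi.sub_apply, Pi.mul_apply, Pi.neg_apply, smallParam]
  field_simp
  linear_combination (c ε t * Real.sin (n * φ ε t / ε)) * hw ε t

/-- Oscillatory integral estimate, cosine version. -/
lemma Slow.weakBigO_mul_cos {n : ℝ} (hn : n ≠ 0) (hφ : HasTimeDeriv ε₀ T φ φ')
    (hφw : UnifBigO ε₀ T 1 (φ' - w)) (hwi : Slow ε₀ T wi)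
    (hw : ∀ ε t, w ε t * wi ε t = 1) (hc : Slow ε₀ T c) :
    WeakBigO ε₀ T 1 (c * fun ε t => Real.cos (n * φ ε t / ε)) := by
  have hd := hc.mul (hwi.mul (Slow.const n⁻¹))
  obtain ⟨hdb, d', hd', hd'b⟩ := hd
  refine ⟨smallParam * ((c * (wi * fun _ _ => n⁻¹)) * fun ε t => Real.sin (n * φ ε t / ε)),
    -(smallParam * (d' * fun ε t => Real.sin (n * φ ε t / ε)))
      - (φ' - w) * (c * wi * fun ε t => Real.cos (n * φ ε t / ε)),
    (hdb.mul (.sin_phase n)).smallParam_mul,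
    (hd'b.mul (.sin_phase n)).smallParam_mul.neg.sub
      (hφw.mul_bdd ((hc.bdd.mul hwi.bdd).mul (.cos_phase n))), fun ε hε t ht => ?_⟩
  have hε0 : ε ≠ 0 := hε.1.ne'
  have h1 := (((hφ ε hε t ht).const_mul n).div_const ε).sin
  have h2 := ((hd' ε hε t ht).mul h1).const_mul ε
  refine h2.congr_deriv ?_
  simp only [Pi.sub_apply, Pi.mul_apply, Pi.neg_apply, smallParam]
  field_simp
  linear_combination (c ε t * Real.cos (n * φ ε t / ε)) * hw ε t

end Oscillation

/-- Grönwall estimate for a first-order system `u' = v + F`, `v' = H + G` with `|H| ≤ L |u|` and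
weakly small forcing terms `F` and `G`. -/
lemma UnifBigO.of_gronwall (hT : 0 ≤ T) {u v H : ℝ → ℝ → ℝ} {L : ℝ} (hL : 0 ≤ L)
    (hu : HasTimeDeriv ε₀ T u (v + F)) (hv : HasTimeDeriv ε₀ T v (H + G))
    (hH : ∀ ε ∈ Ioo 0 ε₀, ∀ t ∈ Icc 0 T, |H ε t| ≤ L * |u ε t|)
    (hF : WeakBigO ε₀ T k F) (hG : WeakBigO ε₀ T k G)
    (hu0 : ∀ ε ∈ Ioo 0 ε₀, u ε 0 = 0) (hv0 : ∀ ε ∈ Ioo 0 ε₀, v ε 0 = 0) :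
    UnifBigO ε₀ T k u ∧ UnifBigO ε₀ T k v := by
  obtain ⟨A, R, ⟨a, ha, hA⟩, ⟨r, hr, hR⟩, hAd⟩ := hF
  obtain ⟨B, S, ⟨b, hb, hB⟩, ⟨s, hs, hS⟩, hBd⟩ := hG
  set K : ℝ := L + 1 with hK
  have hKpos : 0 < K := by positivity
  set m : ℝ := a + b + r + s + L * a with hm
  have hm0 : 0 ≤ m := by positivity
  set N : ℝ := (a + b) * Real.exp (K * T) + m / K * Real.exp (K * T) with hN
  have hN0 : 0 ≤ N := by positivity
  have key : ∀ ε ∈ Ioo 0 ε₀, ∀ t ∈ Icc 0 T,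
      |u ε t - A ε t| ≤ N * ε ^ k ∧ |v ε t - B ε t| ≤ N * ε ^ k := by
    intro ε hε t ht
    have hεk : 0 ≤ ε ^ k := pow_nonneg hε.1.le _
    have hder : ∀ x ∈ Icc 0 T, HasDerivAt (fun x => ((u ε x - A ε x, v ε x - B ε x) : ℝ × ℝ))
        (v ε x + R ε x, H ε x + S ε x) x := by
      intro x hx
      have h1 := (hu ε hε x hx).sub (hAd ε hε x hx)
      have h2 := (hv ε hε x hx).sub (hBd ε hε x hx)
      refine HasDerivAt.prodMk (h1.congr_deriv ?_) (h2.congr_deriv ?_) <;>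
      · simp only [Pi.add_apply, Pi.sub_apply]; ring
    have h0 : (0:ℝ) ∈ Icc 0 T := ⟨le_rfl, hT⟩
    have hgr := norm_le_gronwallBound_of_norm_deriv_right_le (δ := (a + b) * ε ^ k) (K := K)
      (ε := m * ε ^ k)
      (fun x hx => (hder x hx).continuousAt.continuousWithinAt)
      (fun x hx => (hder x (Ico_subset_Icc_self hx)).hasDerivWithinAt)
      (by
        rw [Prod.norm_def, hu0 ε hε, hv0 ε hε, zero_sub, zero_sub, norm_neg, norm_neg,
          Real.norm_eq_abs, Real.norm_eq_abs]
        have h1 := hA ε hε 0 h0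
        have h2 := hB ε hε 0 h0
        have h3 : 0 ≤ a * ε ^ k := by positivity
        have h4 : 0 ≤ b * ε ^ k := by positivity
        exact max_le (by linarith) (by linarith))
      (by
        intro x hx
        have hx := Ico_subset_Icc_self hx
        have hA := hA ε hε x hx
        have hB := hB ε hε x hx
        have hR := hR ε hε x hx
        have hS := hS ε hε x hx
        have hH := hH ε hε x hx
        have hU : |u ε x - A ε x| ≤ ‖((u ε x - A ε x, v ε x - B ε x) : ℝ × ℝ)‖ :=
          norm_fst_le (u ε x - A ε x, v ε x - B ε x)
        have hV : |v ε x - B ε x| ≤ ‖((u ε x - A ε x, v ε x - B ε x) : ℝ × ℝ)‖ :=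
          norm_snd_le (u ε x - A ε x, v ε x - B ε x)
        set n := ‖((u ε x - A ε x, v ε x - B ε x) : ℝ × ℝ)‖
        have hn : 0 ≤ n := norm_nonneg _
        have h1 : |u ε x| ≤ n + a * ε ^ k := by
          have := abs_sub_abs_le_abs_sub (u ε x) (A ε x); linarith
        have h2 : |v ε x| ≤ n + b * ε ^ k := by
          have := abs_sub_abs_le_abs_sub (v ε x) (B ε x); linarith
        have h3 : L * |u ε x| ≤ L * (n + a * ε ^ k) := mul_le_mul_of_nonneg_left h1 hL
        have h4 := abs_add_le (v ε x) (R ε x)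
        have h5 := abs_add_le (H ε x) (S ε x)
        have p1 : 0 ≤ a * ε ^ k := by positivity
        have p2 : 0 ≤ b * ε ^ k := by positivity
        have p3 : 0 ≤ r * ε ^ k := by positivity
        have p4 : 0 ≤ s * ε ^ k := by positivity
        have p5 : 0 ≤ L * a * ε ^ k := by positivity
        have p6 : 0 ≤ L * n := by positivity
        rw [Prod.norm_def, Real.norm_eq_abs, Real.norm_eq_abs]
        refine max_le ?_ ?_
        · simp only [hK, hm]; linarith
        · simp only [hK, hm]; linarith)
      t ht
    rw [sub_zero, gronwallBound_of_K_ne_0 hKpos.ne'] at hgr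
    have hexp : Real.exp (K * t) ≤ Real.exp (K * T) :=
      Real.exp_le_exp.2 (mul_le_mul_of_nonneg_left ht.2 hKpos.le)
    have hfin : (a + b) * ε ^ k * Real.exp (K * t) + m * ε ^ k / K * (Real.exp (K * t) - 1)
        ≤ N * ε ^ k := by
      have e1 : (a + b) * ε ^ k * Real.exp (K * t) ≤ (a + b) * ε ^ k * Real.exp (K * T) := by
        gcongr
      have e2 : m * ε ^ k / K * (Real.exp (K * t) - 1) ≤ m * ε ^ k / K * Real.exp (K * T) :=
        mul_le_mul_of_nonneg_left (by linarith) (by positivity)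
      calc _ ≤ _ := add_le_add e1 e2
        _ = N * ε ^ k := by rw [hN]; ring
    have hgr := hgr.trans hfin
    exact ⟨(norm_fst_le _).trans hgr, (norm_snd_le _).trans hgr⟩
  have hU : UnifBigO ε₀ T k (u - A) := ⟨N, hN0, fun ε hε t ht => (key ε hε t ht).1⟩
  have hV : UnifBigO ε₀ T k (v - B) := ⟨N, hN0, fun ε hε t ht => (key ε hε t ht).2⟩
  exact ⟨(hU.add ⟨a, ha, hA⟩).congr fun ε _ t _ => by simp,
    (hV.add ⟨b, hb, hB⟩).congr fun ε _ t _ => by simp⟩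

end Calculus

/-- The scaled residuals `θ₁^ε = ε⁻¹(θ_ε − θ_*)`,
`φ₂^ε = ε⁻²(φ_ε − φ₀)`, `y₂^ε = ε⁻²(y_ε − y₀)`, `p₂^ε = ε⁻²(p_ε − p₀)` are
uniformly bounded in `L^∞((0,T))` as `ε → 0`. -/
theorem stmt9 (T : ℝ) (hT : 0 < T)
    (ω : ℝ → ℝ) (hω : ContDiff ℝ (⊤ : ℕ∞) ω)
    (ωs : ℝ) (hωs : 0 < ωs) (hωlb : ∀ x, ωs ≤ ω x)
    (φ θ y p : ℝ → ℝ → ℝ)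
    (hreg : ∀ ε > (0:ℝ), ContDiff ℝ 1 (φ ε) ∧ ContDiff ℝ 1 (θ ε) ∧
      ContDiff ℝ 1 (y ε) ∧ ContDiff ℝ 1 (p ε))
    (ys ps us θs : ℝ) (hθs : θs = us ^ 2 / (2 * ω ys))
    (hinit : ∀ ε > (0:ℝ), φ ε 0 = 0 ∧ θ ε 0 = θs ∧ y ε 0 = ys ∧ p ε 0 = ps)
    (hφode : ∀ ε > (0:ℝ), ∀ t ∈ Icc (0:ℝ) T,
      deriv (φ ε) t = ω (y ε t)
        + ε * (p ε t * deriv ω (y ε t) / (2 * ω (y ε t))) * Real.sin (2 * φ ε t / ε)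
        + ε ^ 2 * (θ ε t * (deriv ω (y ε t)) ^ 2 / (4 * (ω (y ε t)) ^ 2))
            * (Real.sin (2 * φ ε t / ε)) ^ 2)
    (hθode : ∀ ε > (0:ℝ), ∀ t ∈ Icc (0:ℝ) T,
      deriv (θ ε) t
        = -(θ ε t * p ε t * deriv ω (y ε t) / ω (y ε t)) * Real.cos (2 * φ ε t / ε)
          - ε * ((θ ε t) ^ 2 * (deriv ω (y ε t)) ^ 2 / (4 * (ω (y ε t)) ^ 2))
              * Real.sin (4 * φ ε t / ε))
    (hyode : ∀ ε > (0:ℝ), ∀ t ∈ Icc (0:ℝ) T,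
      deriv (y ε) t = p ε t
        + ε * (θ ε t * deriv ω (y ε t) / (2 * ω (y ε t))) * Real.sin (2 * φ ε t / ε))
    (hpode : ∀ ε > (0:ℝ), ∀ t ∈ Icc (0:ℝ) T,
      deriv (p ε) t = -(θ ε t * deriv ω (y ε t))
        + ε * (θ ε t * p ε t * (deriv ω (y ε t)) ^ 2 / (2 * (ω (y ε t)) ^ 2))
            * Real.sin (2 * φ ε t / ε)
        - ε * (θ ε t * p ε t * deriv (deriv ω) (y ε t) / (2 * ω (y ε t)))
            * Real.sin (2 * φ ε t / ε)
        + ε ^ 2 * ((θ ε t) ^ 2 * (deriv ω (y ε t)) ^ 3 / (4 * (ω (y ε t)) ^ 3))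
            * (Real.sin (2 * φ ε t / ε)) ^ 2
        - ε ^ 2 * ((θ ε t) ^ 2 * deriv ω (y ε t) * deriv (deriv ω) (y ε t)
              / (4 * (ω (y ε t)) ^ 2))
            * (Real.sin (2 * φ ε t / ε)) ^ 2)
    (φ₀ y₀ p₀ : ℝ → ℝ)
    (hlimreg : ContDiff ℝ 1 φ₀ ∧ ContDiff ℝ 1 y₀ ∧ ContDiff ℝ 1 p₀)
    (hliminit : φ₀ 0 = 0 ∧ y₀ 0 = ys ∧ p₀ 0 = ps)
    (hlimode : ∀ t ∈ Icc (0:ℝ) T,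
      deriv φ₀ t = ω (y₀ t) ∧ deriv y₀ t = p₀ t ∧
      deriv p₀ t = -(θs * deriv ω (y₀ t)))
    (hconv_y : TendstoUniformlyOn (fun ε t => y ε t) y₀ (𝓝[>] (0:ℝ)) (Icc 0 T))
    (hconv_p : TendstoUniformlyOn (fun ε t => p ε t) p₀ (𝓝[>] (0:ℝ)) (Icc 0 T))
    (hconv_θ : TendstoUniformlyOn (fun ε t => θ ε t) (fun _ => θs) (𝓝[>] (0:ℝ)) (Icc 0 T))
    (hconv_φ : TendstoUniformlyOn (fun ε t => φ ε t) φ₀ (𝓝[>] (0:ℝ)) (Icc 0 T))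
    :
    ∃ ε₀ > (0:ℝ), ∃ M : ℝ, ∀ ε : ℝ, 0 < ε → ε < ε₀ → ∀ t ∈ Icc (0:ℝ) T,
      |θ ε t - θs| ≤ M * ε ∧
      |φ ε t - φ₀ t| ≤ M * ε ^ 2 ∧
      |y ε t - y₀ t| ≤ M * ε ^ 2 ∧
      |p ε t - p₀ t| ≤ M * ε ^ 2 := by
  -- a priori bounds
  obtain ⟨Y, hY⟩ := isCompact_Icc.exists_bound_of_continuousOn
    (hlimreg.2.1.continuous.continuousOn (s := Icc 0 T))
  obtain ⟨P, hP⟩ := isCompact_Icc.exists_bound_of_continuousOn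
    (hlimreg.2.2.continuous.continuousOn (s := Icc 0 T))
  obtain ⟨ε₀, hε₀, hε₀1, hclose⟩ : ∃ ε₀ > (0:ℝ), ε₀ ≤ 1 ∧ ∀ ε ∈ Ioo 0 ε₀, ∀ t ∈ Icc 0 T,
      |y ε t - y₀ t| < 1 ∧ |p ε t - p₀ t| < 1 ∧ |θ ε t - θs| < 1 := by
    have h := (Metric.tendstoUniformlyOn_iff.1 hconv_y 1 one_pos).and
      ((Metric.tendstoUniformlyOn_iff.1 hconv_p 1 one_pos).and
        (Metric.tendstoUniformlyOn_iff.1 hconv_θ 1 one_pos))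
    obtain ⟨δ, hδ, hsub⟩ := mem_nhdsGT_iff_exists_Ioo_subset.1 h
    refine ⟨min δ 1, lt_min hδ one_pos, min_le_right _ _, fun ε hε t ht => ?_⟩
    obtain ⟨h1, h2, h3⟩ := hsub ⟨hε.1, hε.2.trans_le (min_le_left _ _)⟩
    have h1 := h1 t ht
    have h2 := h2 t ht
    have h3 := h3 t ht
    rw [dist_comm, Real.dist_eq] at h1 h2 h3
    exact ⟨h1, h2, h3⟩
  have hyR : ∀ ε ∈ Ioo 0 ε₀, ∀ t ∈ Icc 0 T, |y ε t| ≤ Y + 1 := fun ε hε t ht => by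
    have h1 := (hclose ε hε t ht).1
    have h2 := hY t ht
    rw [Real.norm_eq_abs] at h2
    have := abs_sub_abs_le_abs_sub (y ε t) (y₀ t)
    linarith
  have hpb : UnifBigO ε₀ T 0 p := .of_abs_le (M := P + 1) fun ε hε t ht => by
    have h1 := (hclose ε hε t ht).2.1
    have h2 := hP t ht
    rw [Real.norm_eq_abs] at h2
    have := abs_sub_abs_le_abs_sub (p ε t) (p₀ t)
    linarith
  have hθb : UnifBigO ε₀ T 0 θ := .of_abs_le (M := |θs| + 1) fun ε hε t ht => by
    have h1 := (hclose ε hε t ht).2.2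
    have := abs_sub_abs_le_abs_sub (θ ε t) θs
    linarith
  -- the coefficients
  have hωpos : ∀ x, 0 < ω x := fun x => hωs.trans_le (hωlb x)
  have hω1 : ContDiff ℝ (⊤ : ℕ∞) (deriv ω) := (contDiff_infty_iff_deriv.1 hω).2
  have hω2 : ContDiff ℝ (⊤ : ℕ∞) (deriv (deriv ω)) := (contDiff_infty_iff_deriv.1 hω1).2
  have hω3 : ContDiff ℝ (⊤ : ℕ∞) (deriv (deriv (deriv ω))) := (contDiff_infty_iff_deriv.1 hω2).2
  have dω : ∀ x, HasDerivAt ω (deriv ω x) x := fun x =>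
    ((contDiff_infty_iff_deriv.1 hω).1 x).hasDerivAt
  have dω1 : ∀ x, HasDerivAt (deriv ω) (deriv (deriv ω) x) x := fun x =>
    ((contDiff_infty_iff_deriv.1 hω1).1 x).hasDerivAt
  have dω2 : ∀ x, HasDerivAt (deriv (deriv ω)) (deriv (deriv (deriv ω)) x) x := fun x =>
    ((contDiff_infty_iff_deriv.1 hω2).1 x).hasDerivAt
  have dωi : ∀ x, HasDerivAt (fun x => (ω x)⁻¹) (-deriv ω x / ω x ^ 2) x := fun x =>
    (dω x).inv (hωpos x).ne'
  have cωi : Continuous fun x => (ω x)⁻¹ := hω.continuous.inv₀ fun x => (hωpos x).ne'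
  have cωi' : Continuous fun x => -deriv ω x / ω x ^ 2 :=
    hω1.continuous.neg.div (hω.continuous.pow 2) fun x => pow_ne_zero 2 (hωpos x).ne'
  obtain ⟨w, hw⟩ : ∃ w : ℝ → ℝ → ℝ, w = fun ε t => ω (y ε t) := ⟨_, rfl⟩
  obtain ⟨w1, hw1⟩ : ∃ w : ℝ → ℝ → ℝ, w = fun ε t => deriv ω (y ε t) := ⟨_, rfl⟩
  obtain ⟨w2, hw2⟩ : ∃ w : ℝ → ℝ → ℝ, w = fun ε t => deriv (deriv ω) (y ε t) := ⟨_, rfl⟩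
  obtain ⟨wi, hwi⟩ : ∃ w : ℝ → ℝ → ℝ, w = fun ε t => (ω (y ε t))⁻¹ := ⟨_, rfl⟩
  obtain ⟨S2, hS2⟩ : ∃ f : ℝ → ℝ → ℝ, f = fun ε t => Real.sin (2 * φ ε t / ε) := ⟨_, rfl⟩
  obtain ⟨C2, hC2⟩ : ∃ f : ℝ → ℝ → ℝ, f = fun ε t => Real.cos (2 * φ ε t / ε) := ⟨_, rfl⟩
  obtain ⟨S4, hS4⟩ : ∃ f : ℝ → ℝ → ℝ, f = fun ε t => Real.sin (4 * φ ε t / ε) := ⟨_, rfl⟩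
  obtain ⟨κ, hκ⟩ : ∃ f : ℝ → ℝ → ℝ → ℝ, f = fun c _ _ => c := ⟨_, rfl⟩
  have hwwi : ∀ ε t, w ε t * wi ε t = 1 := fun ε t => by
    rw [hw, hwi]; exact mul_inv_cancel₀ (hωpos _).ne'
  have hS4' : ∀ ε t, S4 ε t = 2 * (S2 ε t * C2 ε t) := fun ε t => by
    simp only [hS4, hS2, hC2]
    rw [← mul_assoc, ← Real.sin_two_mul]
    ring_nf
  have S2b : UnifBigO ε₀ T 0 S2 := hS2 ▸ .sin_phase 2
  have C2b : UnifBigO ε₀ T 0 C2 := hC2 ▸ .cos_phase 2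
  have S4b : UnifBigO ε₀ T 0 S4 := hS4 ▸ .sin_phase 4
  have κs : ∀ c, Slow ε₀ T (κ c) := hκ ▸ fun c => .const c
  have κb : ∀ c, UnifBigO ε₀ T 0 (κ c) := fun c => (κs c).bdd
  have w1b : UnifBigO ε₀ T 0 w1 := hw1 ▸ .comp hyR hω1.continuous
  have w2b : UnifBigO ε₀ T 0 w2 := hw2 ▸ .comp hyR hω2.continuous
  have wib : UnifBigO ε₀ T 0 wi := hwi ▸ .comp hyR cωi
  -- the system, written in terms of the coefficients
  obtain ⟨φ', hφ'⟩ : ∃ f : ℝ → ℝ → ℝ, f = fun ε t => deriv (φ ε) t := ⟨_, rfl⟩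
  obtain ⟨θ', hθ'⟩ : ∃ f : ℝ → ℝ → ℝ, f = fun ε t => deriv (θ ε) t := ⟨_, rfl⟩
  obtain ⟨y', hy'⟩ : ∃ f : ℝ → ℝ → ℝ, f = fun ε t => deriv (y ε) t := ⟨_, rfl⟩
  obtain ⟨p', hp'⟩ : ∃ f : ℝ → ℝ → ℝ, f = fun ε t => deriv (p ε) t := ⟨_, rfl⟩
  have dφ : HasTimeDeriv ε₀ T φ φ' := fun ε hε t _ => by
    rw [hφ']; exact (((hreg ε hε.1).1.differentiable one_ne_zero) t).hasDerivAt
  have dθ : HasTimeDeriv ε₀ T θ θ' := fun ε hε t _ => by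
    rw [hθ']; exact (((hreg ε hε.1).2.1.differentiable one_ne_zero) t).hasDerivAt
  have dy : HasTimeDeriv ε₀ T y y' := fun ε hε t _ => by
    rw [hy']; exact (((hreg ε hε.1).2.2.1.differentiable one_ne_zero) t).hasDerivAt
  have dp : HasTimeDeriv ε₀ T p p' := fun ε hε t _ => by
    rw [hp']; exact (((hreg ε hε.1).2.2.2.differentiable one_ne_zero) t).hasDerivAt
  have eφ : ∀ ε ∈ Ioo 0 ε₀, ∀ t ∈ Icc 0 T, φ' ε t = w ε t
      + ε * (p ε t * w1 ε t * wi ε t * (1 / 2) * S2 ε t)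
      + ε * (ε * (θ ε t * w1 ε t * w1 ε t * wi ε t * wi ε t * (1 / 4) * (S2 ε t * S2 ε t))) := by
    intro ε hε t ht
    have h0 := (hωpos (y ε t)).ne'
    simp only [hφ', hw, hw1, hwi, hS2]
    rw [hφode ε hε.1 t ht]
    field_simp
  have eθ : ∀ ε ∈ Ioo 0 ε₀, ∀ t ∈ Icc 0 T, θ' ε t = -(θ ε t * p ε t * w1 ε t * wi ε t * C2 ε t)
      - ε * (θ ε t * θ ε t * w1 ε t * w1 ε t * wi ε t * wi ε t * (1 / 4) * S4 ε t) := by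
    intro ε hε t ht
    have h0 := (hωpos (y ε t)).ne'
    simp only [hθ', hw1, hwi, hC2, hS4]
    rw [hθode ε hε.1 t ht]
    field_simp
  have ey : ∀ ε ∈ Ioo 0 ε₀, ∀ t ∈ Icc 0 T, y' ε t = p ε t
      + ε * (θ ε t * w1 ε t * wi ε t * (1 / 2) * S2 ε t) := by
    intro ε hε t ht
    have h0 := (hωpos (y ε t)).ne'
    simp only [hy', hw1, hwi, hS2]
    rw [hyode ε hε.1 t ht]
    field_simp
  have ep : ∀ ε ∈ Ioo 0 ε₀, ∀ t ∈ Icc 0 T, p' ε t = -(θ ε t * w1 ε t)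
      + ε * ((θ ε t * p ε t * (1 / 2) * (w1 ε t * w1 ε t * wi ε t * wi ε t - w2 ε t * wi ε t))
          * S2 ε t)
      + ε * (ε * (θ ε t * θ ε t * w1 ε t * (1 / 4)
          * (w1 ε t * w1 ε t * wi ε t * wi ε t * wi ε t - w2 ε t * wi ε t * wi ε t)
          * (S2 ε t * S2 ε t))) := by
    intro ε hε t ht
    have h0 := (hωpos (y ε t)).ne'
    simp only [hp', hw1, hw2, hwi, hS2]
    rw [hpode ε hε.1 t ht]
    field_simp
    ring
  have rφ2 : UnifBigO ε₀ T 2 (φ' - w - smallParam * (p * w1 * wi * κ (1 / 2) * S2)) :=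
    ((((((((hθb.mul w1b).mul w1b).mul wib).mul wib).mul (κb (1 / 4))).mul
      (S2b.mul S2b)).smallParam_mul).smallParam_mul).congr fun ε hε t ht => by
        simp only [Pi.sub_apply, Pi.mul_apply, smallParam, eφ ε hε t ht, hκ]; ring
  have rφ : UnifBigO ε₀ T 1 (φ' - w) :=
    ((((((hpb.mul w1b).mul wib).mul (κb (1 / 2))).mul S2b).smallParam_mul).add
      (rφ2.of_succ hε₀1)).congr fun ε hε t ht => by
        simp only [Pi.sub_apply, Pi.mul_apply, Pi.add_apply, smallParam]; ring
  have rθ : UnifBigO ε₀ T 1 (θ' + θ * p * w1 * wi * C2) :=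
    ((((((((hθb.mul hθb).mul w1b).mul w1b).mul wib).mul wib).mul (κb (1 / 4))).mul
      S4b).smallParam_mul).neg.congr fun ε hε t ht => by
        simp only [Pi.neg_apply, Pi.mul_apply, Pi.add_apply, smallParam, eθ ε hε t ht, hκ]; ring
  have ry : UnifBigO ε₀ T 1 (y' - p) :=
    (((((hθb.mul w1b).mul wib).mul (κb (1 / 2))).mul S2b).smallParam_mul).congr
      fun ε hε t ht => by
        simp only [Pi.sub_apply, Pi.mul_apply, smallParam, ey ε hε t ht, hκ]; ring
  have rp2 : UnifBigO ε₀ T 2 (p' + θ * w1 - smallParam *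
      (θ * p * κ (1 / 2) * (w1 * w1 * wi * wi - w2 * wi) * S2)) :=
    (((((((hθb.mul hθb).mul w1b).mul (κb (1 / 4))).mul
      (((((w1b.mul w1b).mul wib).mul wib).mul wib).sub ((w2b.mul wib).mul wib))).mul
      (S2b.mul S2b)).smallParam_mul).smallParam_mul).congr fun ε hε t ht => by
        simp only [Pi.sub_apply, Pi.add_apply, Pi.mul_apply, smallParam, ep ε hε t ht, hκ]; ring
  have rp : UnifBigO ε₀ T 1 (p' + θ * w1) :=
    ((((((hθb.mul hpb).mul (κb (1 / 2))).mul
      ((((w1b.mul w1b).mul wib).mul wib).sub (w2b.mul wib))).mul S2b).smallParam_mul).add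
      (rp2.of_succ hε₀1)).congr fun ε hε t ht => by
        simp only [Pi.sub_apply, Pi.mul_apply, Pi.add_apply, smallParam]; ring
  -- slow quantities
  have θsl : Slow ε₀ T θ := ⟨hθb, θ', dθ,
    ((rθ.of_succ hε₀1).sub ((((hθb.mul hpb).mul w1b).mul wib).mul C2b)).congr
      fun ε _ t _ => by simp⟩
  have ysl : Slow ε₀ T y := ⟨.of_abs_le hyR, y', dy,
    ((ry.of_succ hε₀1).add hpb).congr fun ε _ t _ => by simp⟩
  have psl : Slow ε₀ T p := ⟨hpb, p', dp,
    ((rp.of_succ hε₀1).sub (hθb.mul w1b)).congr fun ε _ t _ => by simp⟩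
  have w1s : Slow ε₀ T w1 := hw1 ▸ ysl.comp hyR dω1 hω2.continuous
  have w2s : Slow ε₀ T w2 := hw2 ▸ ysl.comp hyR dω2 hω3.continuous
  have wis : Slow ε₀ T wi := hwi ▸ ysl.comp hyR dωi cωi'
  have oscS2 : ∀ c, Slow ε₀ T c → WeakBigO ε₀ T 1 (c * S2) := hS2 ▸ fun c hc =>
    Slow.weakBigO_mul_sin two_ne_zero dφ rφ wis hwwi hc
  have oscS4 : ∀ c, Slow ε₀ T c → WeakBigO ε₀ T 1 (c * S4) := hS4 ▸ fun c hc =>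
    Slow.weakBigO_mul_sin four_ne_zero dφ rφ wis hwwi hc
  have oscC2 : ∀ c, Slow ε₀ T c → WeakBigO ε₀ T 1 (c * C2) := hC2 ▸ fun c hc =>
    Slow.weakBigO_mul_cos two_ne_zero dφ rφ wis hwwi hc
  -- first-order estimate for the action
  have θ1 : UnifBigO ε₀ T 1 (θ - κ θs) := by
    have hF : WeakBigO ε₀ T 1 θ' :=
      (rθ.weakBigO.add (oscC2 (κ (-1) * (θ * p * w1 * wi))
        ((κs (-1)).mul (((θsl.mul psl).mul w1s).mul wis)))).congr fun ε _ t _ => by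
          simp only [Pi.add_apply, Pi.mul_apply, hκ]; ring
    have hd : HasTimeDeriv ε₀ T (θ - κ θs) θ' := fun ε hε t ht => by
      rw [hκ]; exact (dθ ε hε t ht).sub_const θs
    exact hF.unifBigO_of_hasTimeDeriv hT.le hd fun ε hε => by
      simp [hκ, (hinit ε hε.1).2.1]
  -- second-order expansion of the action
  obtain ⟨a, ha⟩ : ∃ f : ℝ → ℝ → ℝ, f = w1 * wi * wi * κ (1 / 2) := ⟨_, rfl⟩
  obtain ⟨b, hb⟩ : ∃ f : ℝ → ℝ → ℝ,
    f = w2 * wi * wi * κ (1 / 2) - w1 * w1 * wi * wi * wi := ⟨_, rfl⟩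
  have asl : Slow ε₀ T a := ha ▸ ((w1s.mul wis).mul wis).mul (κs _)
  have bsl : Slow ε₀ T b := hb ▸ (((w2s.mul wis).mul wis).mul (κs _)).sub
    ((((w1s.mul w1s).mul wis).mul wis).mul wis)
  have da : HasTimeDeriv ε₀ T a (b * y') := fun ε hε t ht => by
    have h1 := (dω1 (y ε t)).comp t (dy ε hε t ht)
    have h2 := (dωi (y ε t)).comp t (dy ε hε t ht)
    have h3 := ((h1.mul h2).mul h2).mul_const (1 / 2)
    have e : a ε = fun s => ((deriv ω ∘ y ε) * ((fun x => (ω x)⁻¹) ∘ y ε)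
        * ((fun x => (ω x)⁻¹) ∘ y ε)) s * (1 / 2) := by
      simp only [ha, hw1, hwi, hκ]; rfl
    rw [e]
    refine h3.congr_deriv ?_
    have h0 := (hωpos (y ε t)).ne'
    simp only [hb, hw1, hw2, hwi, hκ, Pi.mul_apply, Pi.sub_apply, Function.comp]
    field_simp
    ring
  have θ2 : UnifBigO ε₀ T 2 (θ - κ θs + smallParam * (θ * (p * a) * S2)) := by
    have dq := dθ.mul (dp.mul da)
    have dS : ∀ ε ∈ Ioo 0 ε₀, ∀ t ∈ Icc 0 T,
        HasDerivAt (S2 ε) (C2 ε t * (2 * φ' ε t / ε)) t := fun ε hε t ht => by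
      rw [hS2, hC2]
      exact (((dφ ε hε t ht).const_mul 2).div_const ε).sin
    have hF := (((oscS4 (κ (-1 / 4) * (θ * θ * w1 * w1 * wi * wi))
        ((κs _).mul (((((θsl.mul θsl).mul w1s).mul w1s).mul wis).mul wis))).add
      (oscS2 (θ * (p * p * b - θ * w1 * a))
        (θsl.mul (((psl.mul psl).mul bsl).sub ((θsl.mul w1s).mul asl))))).smallParam_mul).add
      (((((rθ.mul_bdd (psl.mul asl).bdd).add
        ((((rp.mul_bdd asl.bdd).add (ry.mul_bdd (psl.mul bsl).bdd))).mul_bdd hθb)).mul_bdd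
          S2b).smallParam_mul.add
        (rφ2.mul_bdd (((κb 2).mul (θsl.mul (psl.mul asl)).bdd).mul C2b))).weakBigO)
    refine hF.unifBigO_of_hasTimeDeriv hT.le (fun ε hε t ht => ?_) fun ε hε => ?_
    · have hd := ((dθ ε hε t ht).sub_const θs).add
        (((dq ε hε t ht).mul (dS ε hε t ht)).const_mul ε)
      have e : (θ - κ θs + smallParam * (θ * (p * a) * S2)) ε = fun s =>
          (θ ε s - θs) + ε * ((θ * (p * a)) ε * S2 ε) s := by
        funext s; simp [hκ, smallParam]
      rw [e]
      refine hd.congr_deriv ?_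
      have hε0 : ε ≠ 0 := hε.1.ne'
      have hcanc : w ε t * a ε t = w1 ε t * wi ε t * (1 / 2) := by
        simp only [ha, Pi.mul_apply, hκ]
        linear_combination (w1 ε t * wi ε t * (1 / 2)) * hwwi ε t
      simp only [Pi.add_apply, Pi.sub_apply, Pi.mul_apply, smallParam, hκ]
      have e1 : ε * ((θ' ε t * (p ε t * a ε t) + θ ε t * (p' ε t * a ε t + p ε t * (b ε t * y' ε t)))
            * S2 ε t + θ ε t * (p ε t * a ε t) * (C2 ε t * (2 * φ' ε t / ε)))
          = ε * ((θ' ε t * (p ε t * a ε t) + θ ε t * (p' ε t * a ε t + p ε t * (b ε t * y' ε t)))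
            * S2 ε t) + θ ε t * (p ε t * a ε t) * (C2 ε t * (2 * φ' ε t)) := by
        field_simp
      rw [e1]
      have e2 := eθ ε hε t ht
      have e3 := hS4' ε t
      linear_combination e2 + (2 * θ ε t * p ε t * C2 ε t) * hcanc
    · have h0 := hinit ε hε.1
      simp [hκ, hS2, h0.1, h0.2.1]
  -- comparison with the homogenised system
  have hFy : WeakBigO ε₀ T 2 (y' - p) :=
    (oscS2 (θ * w1 * wi * κ (1 / 2))
      (((θsl.mul w1s).mul wis).mul (κs _))).smallParam_mul.congr fun ε hε t ht => by
        simp only [Pi.sub_apply, Pi.mul_apply, smallParam, ey ε hε t ht, hκ]; ring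
  have hFp : WeakBigO ε₀ T 2 (p' + κ θs * w1) :=
    (((oscS2 (θ * (p * a) * w1) ((θsl.mul (psl.mul asl)).mul w1s)).add
      (oscS2 (θ * p * κ (1 / 2) * (w1 * w1 * wi * wi - w2 * wi))
        (((θsl.mul psl).mul (κs _)).mul
          ((((w1s.mul w1s).mul wis).mul wis).sub (w2s.mul wis))))).smallParam_mul.add
      (rp2.sub (θ2.mul_bdd w1b)).weakBigO).congr fun ε hε t ht => by
        simp only [Pi.sub_apply, Pi.add_apply, Pi.mul_apply, smallParam]; ring
  have hFφ : WeakBigO ε₀ T 2 (φ' - w) :=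
    ((oscS2 (p * w1 * wi * κ (1 / 2))
      (((psl.mul w1s).mul wis).mul (κs _))).smallParam_mul.add rφ2.weakBigO).congr
        fun ε hε t ht => by
          simp only [Pi.sub_apply, Pi.add_apply, Pi.mul_apply, smallParam]; ring
  have hlip : ∀ g : ℝ → ℝ, ContDiff ℝ (⊤ : ℕ∞) g → ∃ L, 0 ≤ L ∧ ∀ ε ∈ Ioo 0 ε₀, ∀ t ∈ Icc 0 T,
      |g (y ε t) - g (y₀ t)| ≤ L * |y ε t - y₀ t| := by
    intro g hg
    have hg' := contDiff_infty_iff_deriv.1 hg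
    obtain ⟨L, hL⟩ := (isCompact_Icc (a := -(Y + 1)) (b := Y + 1)).exists_bound_of_continuousOn
      hg'.2.continuous.continuousOn
    refine ⟨|L|, abs_nonneg L, fun ε hε t ht => ?_⟩
    have h := (convex_Icc (-(Y + 1)) (Y + 1)).norm_image_sub_le_of_norm_deriv_le
      (f := g) (C := |L|) (fun x _ => hg'.1 x) (fun x hx => (hL x hx).trans (le_abs_self L))
      (x := y₀ t) (y := y ε t) (abs_le.1 ((hY t ht).trans (by linarith)))
      (abs_le.1 (hyR ε hε t ht))
    simpa only [Real.norm_eq_abs] using h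
  obtain ⟨L, hL, hLip⟩ := hlip _ hω1
  obtain ⟨L', hL', hLip'⟩ := hlip _ hω
  have d0 : ∀ f : ℝ → ℝ, ContDiff ℝ 1 f → HasTimeDeriv ε₀ T (fun _ => f) (fun _ => deriv f) :=
    fun f hf _ _ t _ => (hf.differentiable one_ne_zero t).hasDerivAt
  obtain ⟨y2, p2⟩ := UnifBigO.of_gronwall (u := y - fun _ => y₀) (v := p - fun _ => p₀)
    (H := fun ε t => -(θs * (deriv ω (y ε t) - deriv ω (y₀ t)))) (L := |θs| * L)
    hT.le (by positivity)
    ((dy.sub (d0 y₀ hlimreg.2.1)).congr fun ε hε t ht => by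
      simp only [Pi.sub_apply, Pi.add_apply, (hlimode t ht).2.1]; ring)
    ((dp.sub (d0 p₀ hlimreg.2.2)).congr fun ε hε t ht => by
      simp only [Pi.sub_apply, Pi.add_apply, Pi.mul_apply, (hlimode t ht).2.2, hw1, hκ]; ring)
    (fun ε hε t ht => by
      rw [abs_neg, abs_mul, mul_assoc]
      exact mul_le_mul_of_nonneg_left (hLip ε hε t ht) (abs_nonneg _))
    hFy hFp
    (fun ε hε => by simp [(hinit ε hε.1).2.2.1, hliminit.2.1])
    (fun ε hε => by simp [(hinit ε hε.1).2.2.2, hliminit.2.2])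
  have w0 : UnifBigO ε₀ T 2 (w - fun _ t => ω (y₀ t)) := by
    obtain ⟨M, hM, hy2⟩ := y2
    refine ⟨L' * M, by positivity, fun ε hε t ht => ?_⟩
    rw [hw, mul_assoc]
    exact (hLip' ε hε t ht).trans (mul_le_mul_of_nonneg_left (hy2 ε hε t ht) hL')
  have φ2 : UnifBigO ε₀ T 2 (φ - fun _ => φ₀) :=
    (hFφ.add w0.weakBigO).unifBigO_of_hasTimeDeriv hT.le
      ((dφ.sub (d0 φ₀ hlimreg.1)).congr fun ε hε t ht => by
        simp only [Pi.sub_apply, Pi.add_apply, (hlimode t ht).1]; ring)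
      fun ε hε => by simp [(hinit ε hε.1).1, hliminit.1]
  obtain ⟨A, hA, hθA⟩ := θ1
  obtain ⟨B, hB, hφB⟩ := φ2
  obtain ⟨C, hC, hyC⟩ := y2
  obtain ⟨D, hD, hpD⟩ := p2
  refine ⟨ε₀, hε₀, A + B + C + D, fun ε h0 h1 t ht => ?_⟩
  have hA' := hθA ε ⟨h0, h1⟩ t ht
  rw [pow_one] at hA'
  refine ⟨?_, (hφB ε ⟨h0, h1⟩ t ht).trans ?_, (hyC ε ⟨h0, h1⟩ t ht).trans ?_,
    (hpD ε ⟨h0, h1⟩ t ht).trans ?_⟩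
  · rw [hκ] at hA'
    exact hA'.trans (mul_le_mul_of_nonneg_right (by linarith) h0.le)
  all_goals exact mul_le_mul_of_nonneg_right (by linarith) (by positivity)
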